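/- For every ε > 0 there exists a constant C = C(ε) > 0 such that for all integers a, b, c, d, e, f with a > 0 and b² − 4ac < 0 (so that the quadratic homogeneous part a x² + b x y + c y² is positive definite), the number of pairs (x, y) ∈ ℤ² with a x² + b x y + c y² + d x + e y + f = 0 is at most C · H^ε, where H = max(|a|, |b|, |c|, |d|, |e|, |f|). -/

import Mathlib

/-- The divisor bound: the number of divisors of `n` is `O(n ^ ε)` for every `ε > 0`. -/
theorem exists_card_divisors_le_rpow (ε : ℝ) (hε : 0 < ε) :
    ∃ C : ℝ, 1 ≤ C ∧ ∀ n : ℕ, n ≠ 0 → (n.divisors.card : ℝ) ≤ C * (n : ℝ) ^ ε := by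
  have hlog : 0 < Real.log 2 := Real.log_pos one_lt_two
  set K : ℝ := 1 + 1 / (ε * Real.log 2) with hK
  have hK1 : 1 ≤ K := by
    have : 0 ≤ 1 / (ε * Real.log 2) := by positivity
    linarith
  obtain ⟨P, hP⟩ := exists_nat_ge ((2 : ℝ) ^ (1 / ε))
  have local_bound : ∀ p k : ℕ, p.Prime →
      ((k : ℝ) + 1) ≤ (if p < P then K else 1) * ((p : ℝ) ^ k) ^ ε := by
    intro p k hp
    have hp2 : (2 : ℝ) ≤ p := by exact_mod_cast hp.two_le
    have hcomm : ((p : ℝ) ^ k) ^ ε = ((p : ℝ) ^ ε) ^ k := by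
      rw [← Real.rpow_natCast, ← Real.rpow_natCast, ← Real.rpow_mul (by positivity),
        ← Real.rpow_mul (by positivity), mul_comm]
    rw [hcomm]
    split_ifs with h
    · have h1 : (1 + ε * Real.log 2) ≤ (p : ℝ) ^ ε := by
        calc 1 + ε * Real.log 2 ≤ Real.exp (Real.log 2 * ε) := by
              have := Real.add_one_le_exp (Real.log 2 * ε)
              linarith
          _ = (2 : ℝ) ^ ε := by rw [Real.rpow_def_of_pos two_pos]
          _ ≤ (p : ℝ) ^ ε := by gcongr
      have h2 : 1 + (k : ℝ) * (ε * Real.log 2) ≤ ((p : ℝ) ^ ε) ^ k :=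
        (one_add_mul_le_pow (by have : 0 < ε * Real.log 2 := by positivity
                                linarith) k).trans (by gcongr)
      calc (k : ℝ) + 1 ≤ K * (1 + (k : ℝ) * (ε * Real.log 2)) := by
            have : K * (1 + (k : ℝ) * (ε * Real.log 2))
                = k + 1 + (k * (ε * Real.log 2) + 1 / (ε * Real.log 2)) := by
              rw [hK]; field_simp; ring
            rw [this]
            have : 0 ≤ k * (ε * Real.log 2) + 1 / (ε * Real.log 2) := by positivity
            linarith
        _ ≤ _ := by gcongr
    · have h1 : (1 + 1 : ℝ) ≤ (p : ℝ) ^ ε := by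
        calc (1 + 1 : ℝ) = ((2 : ℝ) ^ (1 / ε)) ^ ε := by
              rw [← Real.rpow_mul two_pos.le, one_div_mul_cancel hε.ne', Real.rpow_one]; norm_num
          _ ≤ (p : ℝ) ^ ε := by
              gcongr
              exact hP.trans (by exact_mod_cast not_lt.mp h)
      have h2 : 1 + (k : ℝ) * 1 ≤ ((p : ℝ) ^ ε) ^ k :=
        (one_add_mul_le_pow (by norm_num) k).trans (by gcongr)
      linarith
  refine ⟨K ^ P, one_le_pow₀ hK1, fun n hn => ?_⟩
  have hprod : ((n : ℝ)) = ∏ p ∈ n.primeFactors, (p : ℝ) ^ n.factorization p := by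
    conv_lhs => rw [← Nat.prod_factorization_pow_eq_self hn]
    rw [Finsupp.prod]
    push_cast
    rfl
  rw [Nat.card_divisors hn]
  conv_rhs => rw [hprod]
  rw [← Real.finsetProd_rpow _ _ (fun i _ => by positivity)]
  push_cast
  calc ∏ p ∈ n.primeFactors, ((n.factorization p : ℝ) + 1)
      ≤ ∏ p ∈ n.primeFactors,
          ((if p < P then K else 1) * ((p : ℝ) ^ n.factorization p) ^ ε) :=
        Finset.prod_le_prod (fun _ _ => by positivity)
          (fun p hp => local_bound p _ (Nat.prime_of_mem_primeFactors hp))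
    _ = (∏ p ∈ n.primeFactors, (if p < P then K else 1)) *
          ∏ p ∈ n.primeFactors, ((p : ℝ) ^ n.factorization p) ^ ε := Finset.prod_mul_distrib
    _ ≤ _ := by
        gcongr
        rw [← Finset.prod_filter, Finset.prod_const]
        refine pow_le_pow_right₀ hK1 ?_
        calc _ ≤ (Finset.range P).card := Finset.card_le_card (fun p hp => by
              simpa using (Finset.mem_filter.mp hp).2)
          _ = P := Finset.card_range P

/-- The finite set of integer points on `u ^ 2 + D * v ^ 2 = N`, for `D > 0`. -/
noncomputable def normReps (D N : ℤ) : Finset (ℤ × ℤ) :=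
  (Finset.Icc (-N) N ×ˢ Finset.Icc (-N) N).filter fun p => p.1 ^ 2 + D * p.2 ^ 2 = N

theorem mem_normReps {D N : ℤ} (hD : 0 < D) {p : ℤ × ℤ} :
    p ∈ normReps D N ↔ p.1 ^ 2 + D * p.2 ^ 2 = N := by
  simp only [normReps, Finset.mem_filter, Finset.mem_product, Finset.mem_Icc,
    and_iff_right_iff_imp]
  intro h
  have h1 : |p.1| ≤ p.1 ^ 2 := by
    simpa using Int.le_self_sq |p.1|
  have h2 : |p.2| ≤ p.2 ^ 2 := by
    simpa using Int.le_self_sq |p.2|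
  have h3 : p.2 ^ 2 ≤ D * p.2 ^ 2 := le_mul_of_one_le_left (sq_nonneg _) hD
  have h4 := sq_nonneg p.1
  have h5 := sq_nonneg p.2
  exact ⟨abs_le.mp (by linarith), abs_le.mp (by linarith)⟩

theorem Squarefree.dvd_two_of_sq_dvd_four_mul {D h : ℤ} (hD : Squarefree D)
    (hh : h ^ 2 ∣ 4 * D) : h ∣ 2 := by
  rcases Int.even_or_odd' h with ⟨k, rfl | rfl⟩
  · have : k * k ∣ D := by
      have h4 : (4 : ℤ) * (k * k) ∣ 4 * D := by convert hh using 1; ring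
      exact Int.dvd_of_mul_dvd_mul_left (by norm_num) h4
    simpa using mul_dvd_mul_left 2 ((hD k this).dvd : k ∣ 1)
  · have hc : IsCoprime ((2 * k + 1) ^ 2) (4 : ℤ) := by
      have : IsCoprime (2 * k + 1) (2 : ℤ) := ⟨1, -k, by ring⟩
      simpa using this.pow (m := 2) (n := 2)
    have : (2 * k + 1) * (2 * k + 1) ∣ D := by
      rw [← sq]; exact hc.dvd_of_dvd_mul_left hh
    exact (hD _ this).dvd

theorem isCoprime_right_of_sq_add_mul_sq {D M u v : ℤ} (h : u ^ 2 + D * v ^ 2 = M)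
    (huv : IsCoprime u v) : IsCoprime v M := by
  have h1 : IsCoprime v (u ^ 2 + v * (D * v)) :=
    IsCoprime.add_mul_left_right huv.symm.pow_right _
  convert h1 using 1
  rw [← h]; ring

/-- Two primitive representations that have the same gcd invariant relative to a third one are
proportional modulo `M`, up to a factor `2`. -/
theorem dvd_two_mul_cross_of_gcd_eq {D M u₀ v₀ u v u' v' : ℤ} (hD : Squarefree D) (hM : 0 < M)
    (h₀ : u₀ ^ 2 + D * v₀ ^ 2 = M) (h : u ^ 2 + D * v ^ 2 = M) (h' : u' ^ 2 + D * v' ^ 2 = M)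
    (c₀ : IsCoprime u₀ v₀) (c : IsCoprime u v)
    (hg : Int.gcd (u * v₀ - u₀ * v) M = Int.gcd (u' * v₀ - u₀ * v') M) :
    M ∣ 2 * (u * v' - u' * v) := by
  have cv₀ := isCoprime_right_of_sq_add_mul_sq h₀ c₀
  have cv := isCoprime_right_of_sq_add_mul_sq h c
  set g : ℤ := (Int.gcd (u * v₀ - u₀ * v) M : ℤ) with hgdef
  have key : ∀ x y : ℤ, x ^ 2 + D * y ^ 2 = M → (Int.gcd (x * v₀ - u₀ * y) M : ℤ) = g →
      g ∣ x * v₀ - u₀ * y ∧ M / g ∣ x * v₀ + u₀ * y := by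
    intro x y hxy hgg
    have hgA : g ∣ x * v₀ - u₀ * y := hgg ▸ Int.gcd_dvd_left _ _
    have hgM : g ∣ M := hgg ▸ Int.gcd_dvd_right _ _
    have hg0 : g ≠ 0 := fun h0 => hM.ne' (by simpa [h0] using hgM)
    refine ⟨hgA, ?_⟩
    have hpos : 0 < Int.gcd (x * v₀ - u₀ * y) M := Int.gcd_pos_of_ne_zero_right _ hM.ne'
    have hcop : IsCoprime (M / g) ((x * v₀ - u₀ * y) / g) := by
      rw [← hgg]
      exact (Int.isCoprime_iff_gcd_eq_one.mpr (Int.gcd_ediv_gcd_ediv_gcd hpos)).symm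
    obtain ⟨α, hα⟩ := hgA
    obtain ⟨m, hm⟩ := hgM
    have e1 : M / g = m := by rw [hm, Int.mul_ediv_cancel_left _ hg0]
    have e2 : (x * v₀ - u₀ * y) / g = α := by rw [hα, Int.mul_ediv_cancel_left _ hg0]
    rw [e1, e2] at hcop
    rw [e1]
    refine hcop.dvd_of_dvd_mul_left ⟨v₀ ^ 2 - y ^ 2, ?_⟩
    apply mul_left_cancel₀ hg0
    rw [← mul_assoc, ← hα, ← mul_assoc, ← hm]
    linear_combination v₀ ^ 2 * hxy - y ^ 2 * h₀
  obtain ⟨hA, hB⟩ := key u v h rfl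
  obtain ⟨hA', hB'⟩ := key u' v' h' (by rw [hgdef, hg])
  have hgM : g ∣ M := Int.gcd_dvd_right _ _
  set m := M / g with hm
  have hgm : g * m = M := Int.mul_ediv_cancel' hgM
  have hmM : m ∣ M := ⟨g, by rw [← hgm]; ring⟩
  have hgW : g ∣ u * v' - u' * v := by
    refine (cv₀.symm.of_isCoprime_of_dvd_left hgM).dvd_of_dvd_mul_left (y := v₀) ?_
    have := (hA.mul_left v').sub (hA'.mul_left v)
    convert this using 1; ring
  have hmW : m ∣ u * v' - u' * v := by
    refine (cv₀.symm.of_isCoprime_of_dvd_left hmM).dvd_of_dvd_mul_left (y := v₀) ?_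
    have := (hB.mul_left v').sub (hB'.mul_left v)
    convert this using 1; ring
  set k : ℤ := (Int.gcd g m : ℤ) with hk
  have hkg : k ∣ g := Int.gcd_dvd_left _ _
  have hkm : k ∣ m := Int.gcd_dvd_right _ _
  have hkM : k ∣ M := hkg.trans hgM
  have hk2u : k ∣ 2 * u₀ := by
    refine (cv.symm.of_isCoprime_of_dvd_left hkM).dvd_of_dvd_mul_right (z := v) ?_
    have := (hkm.trans hB).sub (hkg.trans hA)
    convert this using 1; ring
  have hkk : k ^ 2 ∣ M := by rw [← hgm, sq]; exact mul_dvd_mul hkg hkm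
  have hk2 : k ∣ 2 := by
    refine hD.dvd_two_of_sq_dvd_four_mul ?_
    refine ((cv₀.symm.of_isCoprime_of_dvd_left hkM).pow (m := 2) (n := 2)).dvd_of_dvd_mul_right ?_
    have := (hkk.mul_left 4).sub (pow_dvd_pow_of_dvd hk2u 2)
    convert this using 1
    rw [← h₀]; ring
  have hlcm : (Int.lcm g m : ℤ) ∣ u * v' - u' * v := Int.coe_lcm_dvd hgW hmW
  have hprod : k * (Int.lcm g m : ℤ) = |M| := by
    rw [← hgm, hk, ← Int.natCast_natAbs, Int.natAbs_mul, ← Int.gcd_mul_lcm, Nat.cast_mul]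
  have := mul_dvd_mul hk2 hlcm
  rwa [hprod, abs_dvd] at this

theorem card_filter_isCoprime_normReps_le {D M : ℤ} (hD : Squarefree D) (hD0 : 0 < D)
    (hM : 0 < M) :
    ((normReps D M).filter fun p => Int.gcd p.1 p.2 = 1).card ≤ 10 * M.natAbs.divisors.card := by
  set S := (normReps D M).filter fun p => Int.gcd p.1 p.2 = 1 with hS
  have memS : ∀ p ∈ S, p.1 ^ 2 + D * p.2 ^ 2 = M ∧ IsCoprime p.1 p.2 := by
    intro p hp
    rw [hS, Finset.mem_filter, mem_normReps hD0] at hp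
    exact ⟨hp.1, Int.isCoprime_iff_gcd_eq_one.mpr hp.2⟩
  rcases S.eq_empty_or_nonempty with h0 | ⟨p₀, hp₀⟩
  · simp [h0]
  obtain ⟨h₀, c₀⟩ := memS p₀ hp₀
  set φ : ℤ × ℤ → ℕ := fun p => Int.gcd (p.1 * p₀.2 - p₀.1 * p.2) M with hφ
  have hfib : ∀ g ∈ S.image φ, (S.filter fun p => φ p = g).card ≤ 10 := by
    intro g hg
    obtain ⟨q, hq, rfl⟩ := Finset.mem_image.mp hg
    obtain ⟨hq1, -⟩ := memS q hq
    set T : ℤ × ℤ → ℤ := fun p => p.1 * q.1 + D * p.2 * q.2 with hT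
    set W : ℤ × ℤ → ℤ := fun p => p.1 * q.2 - q.1 * p.2 with hW
    have hTW : ∀ p ∈ S, T p ^ 2 + D * W p ^ 2 = M ^ 2 := by
      intro p hp
      obtain ⟨h1, -⟩ := memS p hp
      simp only [hT, hW]
      linear_combination (q.1 ^ 2 + D * q.2 ^ 2) * h1 + M * hq1
    have hdvd : ∀ p ∈ S, φ p = φ q → 2 * W p = M * (2 * W p / M) := by
      intro p hp hpq
      obtain ⟨h1, c1⟩ := memS p hp
      exact (Int.mul_ediv_cancel'
        (dvd_two_mul_cross_of_gcd_eq hD hM h₀ h1 hq1 c₀ c1 hpq)).symm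
    have hcard : (Finset.Icc (-2 : ℤ) 2 ×ˢ (Finset.univ : Finset Bool)).card = 10 := by decide
    rw [← hcard]
    refine Finset.card_le_card_of_injOn (fun p => (2 * W p / M, decide (0 ≤ T p))) ?_ ?_
    · intro p hp
      obtain ⟨hp, hpq⟩ := Finset.mem_filter.mp hp
      have e1 := hTW p hp
      have e2 := hdvd p hp hpq
      set k := 2 * W p / M
      have hk : k ^ 2 ≤ 2 ^ 2 := by
        have hM2 : 0 < M ^ 2 := by positivity
        refine le_of_mul_le_mul_left ?_ hM2
        have e3 : (2 * W p) ^ 2 = M ^ 2 * k ^ 2 := by rw [e2]; ring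
        nlinarith [sq_nonneg (T p), mul_nonneg (sub_nonneg.mpr (Int.add_one_le_iff.mpr hD0))
          (sq_nonneg (W p))]
      have hk' := abs_le_of_sq_le_sq' hk (by norm_num)
      rw [Finset.mem_coe, Finset.mem_product, Finset.mem_Icc]
      exact ⟨hk', Finset.mem_univ _⟩
    · intro p hp p' hp' heq
      obtain ⟨hp, hpq⟩ := Finset.mem_filter.mp hp
      obtain ⟨hp', hpq'⟩ := Finset.mem_filter.mp hp'
      simp only [Prod.mk.injEq, decide_eq_decide] at heq
      have hWW : W p = W p' := by
        have e1 := hdvd p hp hpq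
        have e2 := hdvd p' hp' hpq'
        rw [heq.1, ← e2] at e1
        linarith
      have hTT : T p = T p' := by
        have e : T p ^ 2 = T p' ^ 2 := by
          have e1 := hTW p hp
          have e2 := hTW p' hp'
          rw [hWW] at e1
          linarith
        rcases sq_eq_sq_iff_eq_or_eq_neg.mp e with e | e
        · exact e
        · have := heq.2
          by_cases hs : 0 ≤ T p
          · have := this.mp hs; linarith
          · have h2 := mt this.mpr hs; linarith
      simp only [hT, hW] at hTT hWW
      ext
      · apply mul_left_cancel₀ hM.ne'
        rw [← hq1]
        linear_combination q.1 * hTT + D * q.2 * hWW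
      · apply mul_left_cancel₀ hM.ne'
        rw [← hq1]
        linear_combination q.2 * hTT - q.1 * hWW
  refine (Finset.card_le_mul_card_image S 10 hfib).trans ?_
  gcongr
  intro g hg
  obtain ⟨q, -, rfl⟩ := Finset.mem_image.mp hg
  rw [Nat.mem_divisors]
  exact ⟨Int.gcd_dvd_natAbs_right _ _, by simpa using hM.ne'⟩

theorem card_normReps_le_of_squarefree {D N : ℤ} (hD : Squarefree D) (hD0 : 0 < D)
    (hN : 0 < N) : (normReps D N).card ≤ 10 * N.natAbs.divisors.card ^ 2 := by
  have hgdvd : ∀ p ∈ normReps D N, (Int.gcd p.1 p.2 : ℤ) ^ 2 ∣ N := by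
    intro p hp
    rw [mem_normReps hD0] at hp
    rw [← hp]
    exact (pow_dvd_pow_of_dvd (Int.gcd_dvd_left _ _) 2).add
      ((pow_dvd_pow_of_dvd (Int.gcd_dvd_right _ _) 2).mul_left _)
  have hfib : ∀ g ∈ (normReps D N).image (fun p => Int.gcd p.1 p.2),
      ((normReps D N).filter fun p => Int.gcd p.1 p.2 = g).card
        ≤ 10 * N.natAbs.divisors.card := by
    intro g hg
    obtain ⟨q, hq, rfl⟩ := Finset.mem_image.mp hg
    obtain ⟨M, hM⟩ := hgdvd q hq
    set g := Int.gcd q.1 q.2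
    have hg0 : (g : ℤ) ≠ 0 := fun h => hN.ne' (by rw [hM, h]; ring)
    have hgpos : 0 < (g : ℤ) := by positivity
    have hM0 : 0 < M := pos_of_mul_pos_right (hM ▸ hN) (sq_nonneg _)
    have hMN : M.natAbs.divisors.card ≤ N.natAbs.divisors.card := by
      refine Finset.card_le_card (Nat.divisors_subset_of_dvd (by simpa using hN.ne') ?_)
      exact Int.natAbs_dvd_natAbs.mpr ⟨(g : ℤ) ^ 2, by rw [hM]; ring⟩
    refine le_trans ?_ ((card_filter_isCoprime_normReps_le hD hD0 hM0).trans
      (Nat.mul_le_mul_left 10 hMN))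
    have hdiv : ∀ p : ℤ × ℤ, Int.gcd p.1 p.2 = g →
        (g : ℤ) * (p.1 / g) = p.1 ∧ (g : ℤ) * (p.2 / g) = p.2 := fun p hp =>
      ⟨Int.mul_ediv_cancel' (hp ▸ Int.gcd_dvd_left _ _),
        Int.mul_ediv_cancel' (hp ▸ Int.gcd_dvd_right _ _)⟩
    refine Finset.card_le_card_of_injOn (fun p => (p.1 / g, p.2 / g)) ?_ ?_
    · intro p hp
      obtain ⟨hp, hpg⟩ := Finset.mem_filter.mp hp
      rw [mem_normReps hD0] at hp
      obtain ⟨e1, e2⟩ := hdiv p hpg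
      simp only [Finset.coe_filter, Set.mem_ofPred_eq, mem_normReps hD0]
      constructor
      · apply mul_left_cancel₀ (pow_ne_zero 2 hg0)
        rw [← hM]
        conv_rhs => rw [← hp, ← e1, ← e2]
        ring
      · have := Int.gcd_ediv_gcd_ediv_gcd (i := p.1) (j := p.2)
          (by rw [hpg]; exact_mod_cast hgpos)
        rwa [hpg] at this
    · intro p hp p' hp' heq
      obtain ⟨-, hpg⟩ := Finset.mem_filter.mp hp
      obtain ⟨-, hpg'⟩ := Finset.mem_filter.mp hp'
      obtain ⟨e1, e2⟩ := hdiv p hpg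
      obtain ⟨e1', e2'⟩ := hdiv p' hpg'
      simp only [Prod.mk.injEq] at heq
      ext
      · rw [← e1, ← e1', heq.1]
      · rw [← e2, ← e2', heq.2]
  refine (Finset.card_le_mul_card_image _ _ hfib).trans ?_
  rw [sq, ← mul_assoc]
  gcongr
  intro g hg
  obtain ⟨q, hq, rfl⟩ := Finset.mem_image.mp hg
  rw [Nat.mem_divisors]
  refine ⟨?_, by simpa using hN.ne'⟩
  exact Int.natCast_dvd.mp ((dvd_pow_self _ two_ne_zero).trans (hgdvd q hq))

theorem card_normReps_le {D N : ℤ} (hD : 0 < D) (hN : 0 < N) :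
    (normReps D N).card ≤ 10 * N.natAbs.divisors.card ^ 2 := by
  obtain ⟨D₀, s, hD₀, hs, hDs, hsf⟩ :=
    Nat.sq_mul_squarefree_of_pos (n := D.natAbs) (by simpa using hD.ne')
  have hD₀' : 0 < (D₀ : ℤ) := by exact_mod_cast hD₀
  have hs' : (s : ℤ) ≠ 0 := by exact_mod_cast hs.ne'
  have hDeq : D = (s : ℤ) ^ 2 * D₀ := by
    rw [← Int.natAbs_of_nonneg hD.le, ← hDs]; push_cast; ring
  refine le_trans ?_ (card_normReps_le_of_squarefree
    (Int.squarefree_natCast.mpr hsf) hD₀' hN)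
  refine Finset.card_le_card_of_injOn (fun p => (p.1, s * p.2)) ?_ ?_
  · intro p hp
    rw [Finset.mem_coe, mem_normReps hD] at hp
    rw [Finset.mem_coe, mem_normReps hD₀', ← hp, hDeq]
    ring
  · intro p _ p' _ heq
    simp only [Prod.mk.injEq] at heq
    ext
    · exact heq.1
    · exact mul_left_cancel₀ hs' heq.2

theorem card_normReps_le_one {D N : ℤ} (hD : 0 < D) (hN : N ≤ 0) :
    (normReps D N).card ≤ 1 := by
  have key : ∀ p ∈ normReps D N, p = 0 := by
    intro p hp
    rw [mem_normReps hD] at hp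
    have h1 := sq_nonneg p.1
    have h2 : 0 ≤ D * p.2 ^ 2 := by positivity
    have h3 : p.1 ^ 2 = 0 := by linarith
    have h4 : D * p.2 ^ 2 = 0 := by linarith
    ext
    · simpa using h3
    · simpa [hD.ne'] using h4
  exact Finset.card_le_one.mpr fun p hp q hq => (key p hp).trans (key q hq).symm

theorem integral_points_on_definite_conic :
    ∀ ε : ℝ, 0 < ε → ∃ C : ℝ, 0 < C ∧
      ∀ a b c d e f : ℤ, 0 < a → b ^ 2 - 4 * a * c < 0 →
        {p : ℤ × ℤ | a * p.1 ^ 2 + b * p.1 * p.2 + c * p.2 ^ 2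
            + d * p.1 + e * p.2 + f = 0}.Finite ∧
        (Nat.card {p : ℤ × ℤ | a * p.1 ^ 2 + b * p.1 * p.2 + c * p.2 ^ 2
            + d * p.1 + e * p.2 + f = 0} : ℝ)
          ≤ C * ((max (max (max |a| |b|) (max |c| |d|)) (max |e| |f|) : ℤ) : ℝ) ^ ε := by
  intro ε hε
  obtain ⟨K, hK1, hK⟩ := exists_card_divisors_le_rpow (ε / 8) (by positivity)
  have h29 : (1 : ℝ) ≤ (29 : ℝ) ^ (ε / 4) :=
    Real.one_le_rpow (by norm_num) (by positivity)
  refine ⟨10 * K ^ 2 * (29 : ℝ) ^ (ε / 4), by positivity, ?_⟩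
  intro a b c d e f ha hdisc
  set H : ℤ := max (max (max |a| |b|) (max |c| |d|)) (max |e| |f|) with hH
  have haH : |a| ≤ H := by simp [hH]
  have hbH : |b| ≤ H := by simp [hH]
  have hcH : |c| ≤ H := by simp [hH]
  have hdH : |d| ≤ H := by simp [hH]
  have heH : |e| ≤ H := by simp [hH]
  have hfH : |f| ≤ H := by simp [hH]
  have hH1 : 1 ≤ H := by
    have := le_abs_self a
    linarith
  have hH1' : (1 : ℝ) ≤ (H : ℝ) := by exact_mod_cast hH1
  set D : ℤ := 4 * a * c - b ^ 2 with hDdef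
  have hD : 0 < D := by linarith
  set N : ℤ := (2 * a * e - b * d) ^ 2 - D * (4 * a * f - d ^ 2) with hNdef
  set S : Set (ℤ × ℤ) := {p : ℤ × ℤ | a * p.1 ^ 2 + b * p.1 * p.2 + c * p.2 ^ 2
            + d * p.1 + e * p.2 + f = 0} with hS
  set φ : ℤ × ℤ → ℤ × ℤ :=
    fun p => (D * p.2 + (2 * a * e - b * d), 2 * a * p.1 + b * p.2 + d) with hφ
  have hmaps : Set.MapsTo φ S (normReps D N : Set (ℤ × ℤ)) := by
    intro p hp
    rw [Finset.mem_coe, mem_normReps hD]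
    simp only [hS, Set.mem_ofPred_eq] at hp
    simp only [hφ, hNdef, hDdef]
    linear_combination (4 * a * (4 * a * c - b ^ 2)) * hp
  have hinj : Set.InjOn φ S := by
    intro p _ q _ heq
    simp only [hφ, Prod.mk.injEq] at heq
    have h2 : p.2 = q.2 := mul_left_cancel₀ hD.ne' (by linarith [heq.1])
    have h1 : p.1 = q.1 := by
      refine mul_left_cancel₀ (mul_pos two_pos ha).ne' ?_
      have := heq.2
      rw [h2] at this
      linarith
    exact Prod.ext h1 h2
  have hfin : S.Finite := Set.Finite.of_injOn hmaps hinj (Finset.finite_toSet _)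
  refine ⟨hfin, ?_⟩
  have hcard : Nat.card S ≤ (normReps D N).card := by
    rw [Nat.card_coe_set_eq, ← Set.ncard_coe_finset]
    exact Set.ncard_le_ncard_of_injOn φ hmaps hinj (Finset.finite_toSet _)
  have hcard' : (Nat.card S : ℝ) ≤ ((normReps D N).card : ℝ) := by exact_mod_cast hcard
  refine hcard'.trans ?_
  rcases le_or_gt N 0 with hN | hN
  · have h1 : ((normReps D N).card : ℝ) ≤ 1 := by exact_mod_cast card_normReps_le_one hD hN
    have h2 : (1 : ℝ) ≤ (H : ℝ) ^ ε := Real.one_le_rpow hH1' hε.le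
    have h3 : (1 : ℝ) ≤ 10 * K ^ 2 := by nlinarith
    exact h1.trans (one_le_mul_of_one_le_of_one_le
      (one_le_mul_of_one_le_of_one_le h3 h29) h2)
  · have hprod : ∀ x y : ℤ, |x| ≤ H → |y| ≤ H → |x * y| ≤ H ^ 2 := by
      intro x y hx hy
      rw [abs_mul, sq]
      exact mul_le_mul hx hy (abs_nonneg _) (by linarith)
    have hNH : N ≤ 29 * H ^ 4 := by
      have hae := abs_le.mp (hprod a e haH heH)
      have hbd := abs_le.mp (hprod b d hbH hdH)
      have hac := abs_le.mp (hprod a c haH hcH)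
      have haf := abs_le.mp (hprod a f haH hfH)
      have hdd := abs_le.mp (hprod d d hdH hdH)
      have h1 : (2 * a * e - b * d) ^ 2 ≤ (3 * H ^ 2) ^ 2 :=
        sq_le_sq' (by linarith) (by linarith)
      have h2 : D ≤ 4 * H ^ 2 := by linarith [sq_nonneg b]
      have h3 : d ^ 2 - 4 * a * f ≤ 5 * H ^ 2 := by linarith
      have h4 : D * (d ^ 2 - 4 * a * f) ≤ (4 * H ^ 2) * (5 * H ^ 2) :=
        (mul_le_mul_of_nonneg_left h3 hD.le).trans
          (mul_le_mul_of_nonneg_right h2 (by positivity))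
      linarith
    have hNR : (N.natAbs : ℝ) ≤ 29 * (H : ℝ) ^ 4 := by
      rw [Nat.cast_natAbs, abs_of_pos hN]
      exact_mod_cast hNH
    have hdiv := hK N.natAbs (by simpa using hN.ne')
    have hpow : ((N.natAbs : ℝ) ^ (ε / 8)) ^ 2 ≤ (29 : ℝ) ^ (ε / 4) * (H : ℝ) ^ ε := by
      calc ((N.natAbs : ℝ) ^ (ε / 8)) ^ 2 ≤ ((29 * (H : ℝ) ^ 4) ^ (ε / 8)) ^ 2 := by gcongr
        _ = (29 * (H : ℝ) ^ 4) ^ (ε / 4) := by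
            rw [← Real.rpow_natCast, ← Real.rpow_mul (by positivity)]
            congr 1; push_cast; ring
        _ = (29 : ℝ) ^ (ε / 4) * (H : ℝ) ^ ε := by
            rw [Real.mul_rpow (by norm_num) (by positivity), ← Real.rpow_natCast,
              ← Real.rpow_mul (by linarith)]
            congr 2; push_cast; ring
    calc ((normReps D N).card : ℝ) ≤ 10 * (N.natAbs.divisors.card : ℝ) ^ 2 := by
          exact_mod_cast card_normReps_le hD hN
      _ ≤ 10 * (K * (N.natAbs : ℝ) ^ (ε / 8)) ^ 2 := by gcongr
      _ = 10 * K ^ 2 * ((N.natAbs : ℝ) ^ (ε / 8)) ^ 2 := by ring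
      _ ≤ 10 * K ^ 2 * ((29 : ℝ) ^ (ε / 4) * (H : ℝ) ^ ε) := by gcongr
      _ = 10 * K ^ 2 * (29 : ℝ) ^ (ε / 4) * (H : ℝ) ^ ε := by ring
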